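/- Let G be a finite group, p a prime number, and C ≤ G a cyclic subgroup whose order is not divisible by p. Then the function e_C : G → ℂ defined by e_C(g) = 1 if ⟨g_{p'}⟩ is conjugate in G to C and e_C(g) = 0 otherwise lies in RU_{(p)}(G), and it is a primitive idempotent element of the ring RU_{(p)}(G). -/

import Mathlib

open scoped Classical

/-- The subring `ℤ_(p) = ℤ[1/q : q prime, q ≠ p]` of `ℚ`, viewed inside `ℂ`. -/
noncomputable def Zploc (p : ℕ) : Subring ℂ :=
  Subring.closure {z : ℂ | ∃ q : ℕ, q.Prime ∧ q ≠ p ∧ z = (q : ℂ)⁻¹}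

/-- `b` is the `p'`-part of `g`: a power of `g` of order prime to `p` such that
`g * b⁻¹` has `p`-power order. -/
def IspPrimePart {G : Type} [Group G] (p : ℕ) (g b : G) : Prop :=
  b ∈ Subgroup.zpowers g ∧ ¬ p ∣ orderOf b ∧
    (∀ q : ℕ, q.Prime → q ∣ orderOf (g * b⁻¹) → q = p)

/-- Two subgroups of `G` are conjugate in `G`. -/
def SubConj {G : Type} [Group G] (C C' : Subgroup G) : Prop :=
  ∃ g : G, Subgroup.map (MulAut.conj g).toMonoidHom C = C'

/-- The function `e_C : G → ℂ` with `e_C(g) = 1` if `⟨g_{p'}⟩` is conjugate in `G` to `C`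
and `e_C(g) = 0` otherwise. -/
noncomputable def eCycp {G : Type} [Group G] (p : ℕ) (C : Subgroup G) : G → ℂ :=
  fun g => if ∃ b : G, IspPrimePart p g b ∧ SubConj (Subgroup.zpowers b) C then 1 else 0

/-- `RU_(p)(G)`: `ℤ_(p)`-linear combinations, inside the ring of functions `G → ℂ`, of
characters of finite-dimensional complex representations of `G`. -/
noncomputable def RUp (G : Type) [Group G] [Fintype G] (p : ℕ) : Set (G → ℂ) :=
  {f | ∃ (n : ℕ) (c : Fin n → ℂ) (V : Fin n → FDRep ℂ G),
    (∀ i, c i ∈ Zploc p) ∧ f = ∑ i, c i • (V i).character}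

/-- `e` is a primitive idempotent of the (sub)ring with underlying set `S`. -/
def IsPrimitiveIdempotentIn {G : Type} (S : Set (G → ℂ)) (e : G → ℂ) : Prop :=
  e ∈ S ∧ e * e = e ∧ e ≠ 0 ∧
    ∀ e₁ e₂ : G → ℂ, e₁ ∈ S → e₂ ∈ S → e₁ * e₁ = e₁ → e₂ * e₂ = e₂ → e₁ * e₂ = 0 →
      e = e₁ + e₂ → e₁ = 0 ∨ e₂ = 0

/-- The traces of the powers of a finite-order operator on a complex vector space are the power sums
of its eigenvalues, which are algebraic integers, counted with multiplicity. -/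
theorem exists_trace_eq_of_pow_eq_one {V : Type} [AddCommGroup V] [Module ℂ V]
    [FiniteDimensional ℂ V] (A : Module.End ℂ V) {N : ℕ} (hN : N ≠ 0) (hA : A ^ N = 1) :
    ∃ (s : Finset ℂ) (d : ℂ → ℕ), (∀ μ ∈ s, IsIntegral ℤ μ) ∧
      ∀ k : ℕ, LinearMap.trace ℂ V (A ^ k) = ∑ μ ∈ s, d μ * μ ^ k := by
  have hss : A.IsSemisimple := by
    refine Module.End.isSemisimple_of_squarefree_aeval_eq_zero
      (p := (Polynomial.X ^ N - 1 : Polynomial ℂ)) ?_ (by simp [hA])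
    refine Polynomial.Separable.squarefree ?_
    exact Polynomial.separable_X_pow_sub_C (1 : ℂ) (by exact_mod_cast hN) one_ne_zero
  have htop : ⨆ μ, A.eigenspace μ = ⊤ :=
    hss.iSup_maxGenEigenspace_eq_top_iff.mp (Module.End.iSup_maxGenEigenspace_eq_top A)
  have hint := DirectSum.isInternal_submodule_of_iSupIndep_of_iSup_eq_top
    A.eigenspaces_iSupIndep htop
  have hfin : {μ | A.eigenspace μ ≠ ⊥}.Finite := by
    exact WellFoundedGT.finite_ne_bot_of_iSupIndep A.eigenspaces_iSupIndep
  have hpow : ∀ (k : ℕ) (μ : ℂ) (v : V), v ∈ A.eigenspace μ → (A ^ k) v = μ ^ k • v := by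
    intro k μ v hv
    rw [Module.End.mem_eigenspace_iff] at hv
    induction k with
    | zero => simp
    | succ k ih => rw [pow_succ, Module.End.mul_apply, hv, map_smul, ih, smul_smul, pow_succ']
  have hmap : ∀ (k : ℕ) (μ : ℂ), Set.MapsTo (A ^ k) (A.eigenspace μ) (A.eigenspace μ) := by
    intro k μ v hv
    rw [hpow k μ v hv]
    exact Submodule.smul_mem _ _ hv
  refine ⟨hfin.toFinset, fun μ => Module.finrank ℂ (A.eigenspace μ), ?_, ?_⟩
  · intro μ hμ
    obtain ⟨v, hv, hv0⟩ := Submodule.exists_mem_ne_zero_of_ne_bot (hfin.mem_toFinset.mp hμ)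
    have h1 := hpow N μ v hv
    rw [hA, Module.End.one_apply] at h1
    have h2 : μ ^ N = 1 := by
      have h3 : (μ ^ N - 1) • v = 0 := by rw [sub_smul, one_smul, ← h1, sub_self]
      exact sub_eq_zero.mp ((smul_eq_zero.mp h3).resolve_right hv0)
    exact IsIntegral.of_pow (Nat.pos_of_ne_zero hN) (h2 ▸ isIntegral_one)
  · intro k
    rw [LinearMap.trace_eq_sum_trace_restrict' hint hfin (hmap k)]
    refine Finset.sum_congr rfl fun μ _ => ?_
    have h : (A ^ k).restrict (hmap k μ) = μ ^ k • LinearMap.id := by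
      refine LinearMap.ext fun v => Subtype.ext ?_
      exact hpow k μ v v.2
    rw [h, map_smul, LinearMap.trace_id, smul_eq_mul, mul_comm]

/-- Functions with values in the algebraic integers which satisfy the congruence
`F g ^ q ≡ F (g ^ q)` modulo `q` for all primes `q`. -/
def frobeniusCongruent (G : Type) [Group G] : Subring (G → integralClosure ℤ ℂ) where
  carrier := {F | ∀ q : ℕ, q.Prime → ∀ g, (q : integralClosure ℤ ℂ) ∣ F g ^ q - F (g ^ q)}
  one_mem' := by simp
  zero_mem' := fun q hq g => by simp [hq.ne_zero]
  mul_mem' {F F'} h h' := fun q hq g => by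
    have := dvd_add ((h q hq g).mul_right (F' g ^ q)) ((h' q hq g).mul_left (F (g ^ q)))
    convert this using 1
    simp only [Pi.mul_apply]
    ring
  add_mem' {F F'} h h' := fun q hq g => by
    obtain ⟨r, hr⟩ := exists_add_pow_prime_eq hq (F g) (F' g)
    have := dvd_add (dvd_add (h q hq g) (h' q hq g)) (Dvd.intro (F g * F' g * r) rfl)
    convert this using 1
    simp only [Pi.add_apply, hr]
    ring
  neg_mem' {F} h := fun q hq g => by
    rcases hq.eq_two_or_odd' with rfl | ho
    · have := dvd_add (h 2 hq g) (Dvd.intro (F (g ^ 2)) rfl)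
      convert this using 1
      simp only [Pi.neg_apply]
      push_cast
      ring
    · have := (h q hq g).neg_right
      convert this using 1
      simp only [Pi.neg_apply, ho.neg_pow]
      ring

theorem prime_dvd_sum_mul_pow_sub {R ι : Type*} [CommRing R] {q : ℕ} (hq : q.Prime)
    (s : Finset ι) (d : ι → ℕ) (x : ι → R) :
    (q : R) ∣ (∑ i ∈ s, d i * x i) ^ q - ∑ i ∈ s, d i * x i ^ q := by
  induction s using Finset.induction_on with
  | empty => simp [hq.ne_zero]
  | insert i s hi ih =>
    rw [Finset.sum_insert hi, Finset.sum_insert hi]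
    obtain ⟨r, hr⟩ := exists_add_pow_prime_eq hq (d i * x i) (∑ i ∈ s, d i * x i)
    have hd : (q : R) ∣ (d i : R) ^ q - d i := by
      simpa using map_dvd (Int.castRingHom R) (Int.prime_dvd_pow_self_sub hq (d i))
    have := dvd_add (dvd_add (hd.mul_right (x i ^ q)) ih)
      (Dvd.intro (d i * x i * (∑ i ∈ s, d i * x i) * r) rfl)
    convert this using 1
    rw [hr]
    ring

theorem exists_frobeniusCongruent_character {G : Type} [Group G] [Finite G] (V : FDRep ℂ G) :
    ∃ F ∈ frobeniusCongruent G, ∀ g, V.character g = F g := by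
  have key : ∀ g : G, ∃ (s : Finset ℂ) (d : ℂ → ℕ), (∀ μ ∈ s, IsIntegral ℤ μ) ∧
      ∀ k : ℕ, V.character (g ^ k) = ∑ μ ∈ s, d μ * μ ^ k := by
    intro g
    have := exists_trace_eq_of_pow_eq_one (V.ρ g) (orderOf_pos g).ne'
      (by rw [← map_pow, pow_orderOf_eq_one, map_one])
    simpa only [FDRep.character, map_pow] using this
  have hint : ∀ g, IsIntegral ℤ (V.character g) := by
    intro g
    obtain ⟨s, d, hs, h⟩ := key g
    rw [← pow_one g, h]
    refine IsIntegral.sum _ fun μ hμ => ?_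
    exact IsIntegral.mul (natCast_mem (integralClosure ℤ ℂ) _) ((hs μ hμ).pow 1)
  let F : G → integralClosure ℤ ℂ := fun g => ⟨V.character g, hint g⟩
  refine ⟨F, ?_, fun g => rfl⟩
  intro q hq g
  obtain ⟨s, d, hs, h⟩ := key g
  let ν : s → integralClosure ℤ ℂ := fun μ => ⟨μ, hs μ μ.2⟩
  have hc : ∀ k : ℕ, F (g ^ k) = ∑ μ : s, (d μ : integralClosure ℤ ℂ) * ν μ ^ k := by
    intro k
    apply Subtype.ext
    push_cast
    exact (h k).trans (Finset.sum_coe_sort s fun μ => d μ * μ ^ k).symm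
  have h1 := hc 1
  simp only [pow_one] at h1
  rw [h1, hc q]
  exact prime_dvd_sum_mul_pow_sub hq _ _ _

theorem Zploc_exists_natCast_mul_eq_intCast {p : ℕ} (hp : p.Prime) {c : ℂ} (hc : c ∈ Zploc p) :
    ∃ m : ℕ, ¬ p ∣ m ∧ ∃ a : ℤ, m * c = a := by
  induction hc using Subring.closure_induction with
  | mem x hx =>
    obtain ⟨q, hq, hqp, rfl⟩ := hx
    refine ⟨q, fun h => hqp ((Nat.prime_dvd_prime_iff_eq hp hq).mp h).symm, 1, ?_⟩
    have : (q : ℂ) ≠ 0 := by exact_mod_cast hq.ne_zero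
    simp [this]
  | zero => exact ⟨1, hp.not_dvd_one, 0, by simp⟩
  | one => exact ⟨1, hp.not_dvd_one, 1, by simp⟩
  | add x y _ _ hx hy =>
    obtain ⟨m, hm, a, ha⟩ := hx
    obtain ⟨n, hn, b, hb⟩ := hy
    refine ⟨m * n, hp.not_dvd_mul hm hn, n * a + m * b, ?_⟩
    push_cast
    rw [← ha, ← hb]
    ring
  | neg x _ hx =>
    obtain ⟨m, hm, a, ha⟩ := hx
    exact ⟨m, hm, -a, by push_cast; rw [← ha]; ring⟩
  | mul x y _ _ hx hy =>
    obtain ⟨m, hm, a, ha⟩ := hx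
    obtain ⟨n, hn, b, hb⟩ := hy
    refine ⟨m * n, hp.not_dvd_mul hm hn, a * b, ?_⟩
    push_cast
    rw [← ha, ← hb]
    ring

theorem inv_natCast_mem_Zploc {p k : ℕ} (hk : ¬ p ∣ k) : (k : ℂ)⁻¹ ∈ Zploc p := by
  induction k using Nat.recOnMul with
  | zero => simp at hk
  | one => simp
  | prime q hq => exact Subring.subset_closure ⟨q, hq, fun h => hk (h ▸ dvd_rfl), rfl⟩
  | mul a b ha hb =>
    push_cast
    rw [mul_inv]
    exact mul_mem (ha fun h => hk (h.mul_right b)) (hb fun h => hk (h.mul_left a))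

/-- The characters of the finite-dimensional complex representations of a group. -/
noncomputable def characterSubmonoid (G : Type) [Group G] : Submonoid (G → ℂ) where
  carrier := Set.range fun V : FDRep ℂ G => V.character
  one_mem' := by
    refine ⟨FDRep.of (Representation.trivial ℂ G ℂ), ?_⟩
    ext g
    change LinearMap.trace ℂ ℂ (LinearMap.id : ℂ →ₗ[ℂ] ℂ) = 1
    simp
  mul_mem' := by
    rintro _ _ ⟨V, rfl⟩ ⟨W, rfl⟩
    exact ⟨CategoryTheory.MonoidalCategory.tensorObj V W, FDRep.char_tensor V W⟩

/-- The algebra over `ℤ_(p)` generated by the characters of a group. -/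
noncomputable def RUpAlgebra (G : Type) [Group G] (p : ℕ) : Subalgebra (Zploc p) (G → ℂ) :=
  Algebra.adjoin (Zploc p) (characterSubmonoid G)

theorem mem_RUpAlgebra_iff {G : Type} [Group G] [Fintype G] {p : ℕ} {f : G → ℂ} :
    f ∈ RUpAlgebra G p ↔ f ∈ RUp G p := by
  rw [RUpAlgebra, ← Subalgebra.mem_toSubmodule, Algebra.adjoin_eq_span, Submonoid.closure_eq,
    Submodule.mem_span_set']
  constructor
  · rintro ⟨n, c, χ, rfl⟩
    choose V hV using fun i => (χ i).2
    refine ⟨n, fun i => c i, V, fun i => (c i).2, Finset.sum_congr rfl fun i _ => ?_⟩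
    rw [← hV i]
    rfl
  · rintro ⟨n, c, V, hc, rfl⟩
    exact ⟨n, fun i => ⟨c i, hc i⟩, fun i => ⟨(V i).character, V i, rfl⟩, rfl⟩

theorem exists_frobeniusCongruent_of_mem_RUpAlgebra {G : Type} [Group G] [Finite G] {p : ℕ}
    (hp : p.Prime) {f : G → ℂ} (hf : f ∈ RUpAlgebra G p) :
    ∃ m : ℕ, ¬ p ∣ m ∧ ∃ F ∈ frobeniusCongruent G, ∀ g, m * f g = F g := by
  induction hf using Algebra.adjoin_induction with
  | mem f hf =>
    obtain ⟨V, rfl⟩ := hf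
    obtain ⟨F, hF, h⟩ := exists_frobeniusCongruent_character V
    exact ⟨1, hp.not_dvd_one, F, hF, fun g => by simpa using h g⟩
  | algebraMap c =>
    obtain ⟨m, hm, a, ha⟩ := Zploc_exists_natCast_mul_eq_intCast hp c.2
    exact ⟨m, hm, a, intCast_mem _ a, fun g => ha⟩
  | add x y _ _ hx hy =>
    obtain ⟨m, hm, F, hF, h⟩ := hx
    obtain ⟨n, hn, F', hF', h'⟩ := hy
    refine ⟨m * n, hp.not_dvd_mul hm hn, n * F + m * F',
      add_mem (mul_mem (natCast_mem _ n) hF) (mul_mem (natCast_mem _ m) hF'), fun g => ?_⟩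
    simp only [Pi.add_apply, Pi.mul_apply, Pi.natCast_apply]
    push_cast
    rw [← h, ← h']
    ring
  | mul x y _ _ hx hy =>
    obtain ⟨m, hm, F, hF, h⟩ := hx
    obtain ⟨n, hn, F', hF', h'⟩ := hy
    refine ⟨m * n, hp.not_dvd_mul hm hn, F * F', mul_mem hF hF', fun g => ?_⟩
    simp only [Pi.mul_apply]
    push_cast
    rw [← h, ← h']
    ring

/-- The integer-valued elements of `RU_(p)(G)`. -/
noncomputable def integralRUp (G : Type) [Group G] (p : ℕ) : Subring (G → ℤ) :=
  (RUpAlgebra G p).toSubring.comap ((Int.castRingHom ℂ).compLeft G)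

theorem mem_integralRUp_iff {G : Type} [Group G] [Fintype G] {p : ℕ} {f : G → ℤ} :
    f ∈ integralRUp G p ↔ (fun g => (f g : ℂ)) ∈ RUp G p :=
  mem_RUpAlgebra_iff

theorem mem_integralRUp_of_natCast_mul_mem {G : Type} [Group G] {p k : ℕ} (hk : ¬ p ∣ k)
    {f : G → ℤ} (hf : (k : G → ℤ) * f ∈ integralRUp G p) : f ∈ integralRUp G p := by
  have h := (RUpAlgebra G p).smul_mem hf (⟨(k : ℂ)⁻¹, inv_natCast_mem_Zploc hk⟩ : Zploc p)
  have hk0 : (k : ℂ) ≠ 0 := by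
    rintro h0
    exact hk (by simp [Nat.cast_eq_zero.mp h0])
  change _ ∈ RUpAlgebra G p
  convert h using 1
  ext g
  simp [Subring.smul_def, hk0]

theorem intCast_dvd_of_dvd_integralClosure {q : ℕ} (hq : q ≠ 0) {n : ℤ}
    (h : (q : integralClosure ℤ ℂ) ∣ n) : (q : ℤ) ∣ n := by
  obtain ⟨r, hr⟩ := h
  have hr' : (n : ℂ) = q * r := by exact_mod_cast congrArg Subtype.val hr
  have hqc : (q : ℂ) ≠ 0 := by exact_mod_cast hq
  have hqq : (q : ℚ) ≠ 0 := by exact_mod_cast hq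
  have h1 : algebraMap ℚ ℂ (n / q) = r := by
    simp only [map_div₀, map_intCast, map_natCast]
    rw [hr']
    field_simp
  have h2 : IsIntegral ℤ ((n : ℚ) / q) := by
    rw [← isIntegral_algebraMap_iff (algebraMap ℚ ℂ).injective, h1]
    exact r.2
  obtain ⟨z, hz⟩ := IsIntegrallyClosed.isIntegral_iff.mp h2
  refine ⟨z, ?_⟩
  have hz' : (z : ℚ) = n / q := by simpa using hz
  rw [eq_div_iff hqq] at hz'
  have : (n : ℚ) = ((q * z : ℤ) : ℚ) := by push_cast; linarith
  exact_mod_cast this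

theorem exists_dvd_sub_apply_pow_of_mem_integralRUp {G : Type} [Group G] [Finite G] {p : ℕ}
    (hp : p.Prime) {f : G → ℤ} (hf : f ∈ integralRUp G p) :
    ∃ m : ℕ, ¬ p ∣ m ∧ ∀ q : ℕ, q.Prime → ¬ q ∣ m → ∀ g, (q : ℤ) ∣ f g - f (g ^ q) := by
  obtain ⟨m, hm, F, hF, h⟩ := exists_frobeniusCongruent_of_mem_RUpAlgebra hp hf
  refine ⟨m, hm, fun q hq hqm g => ?_⟩
  have hFf : ∀ g, F g = ((m * f g : ℤ) : integralClosure ℤ ℂ) := by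
    intro g
    apply Subtype.ext
    rw [← h g]
    push_cast
    rfl
  have h1 := hF q hq g
  rw [hFf, hFf, ← Int.cast_pow, ← Int.cast_sub] at h1
  have h2 := intCast_dvd_of_dvd_integralClosure hq.ne_zero h1
  have h3 := dvd_sub h2 (Int.prime_dvd_pow_self_sub hq (m * f g))
  have h4 : (q : ℤ) ∣ m * (f g - f (g ^ q)) := by
    rwa [sub_sub_sub_cancel_left, ← mul_sub] at h3
  exact ((Nat.prime_iff_prime_int.mp hq).dvd_or_dvd h4).resolve_left
    fun h => hqm (by exact_mod_cast h)

theorem dvd_sub_apply_pow_pow_of_mem_integralRUp {G : Type} [Group G] [Finite G] {p : ℕ}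
    (hp : p.Prime) {f : G → ℤ} (hf : f ∈ integralRUp G p) (g : G) (n : ℕ) :
    (p : ℤ) ∣ f g - f (g ^ p ^ n) := by
  obtain ⟨m, hm, h⟩ := exists_dvd_sub_apply_pow_of_mem_integralRUp hp hf
  induction n with
  | zero => simp
  | succ n ih =>
    have := dvd_add ih (h p hp hm (g ^ p ^ n))
    rwa [sub_add_sub_cancel, ← pow_mul, ← pow_succ] at this

theorem apply_eq_of_zpowers_eq_of_mem_integralRUp {G : Type} [Group G] [Finite G] {p : ℕ}
    (hp : p.Prime) {f : G → ℤ} (hf : f ∈ integralRUp G p) {g g' : G}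
    (hgg' : Subgroup.zpowers g = Subgroup.zpowers g') : f g = f g' := by
  obtain ⟨m, hm, h⟩ := exists_dvd_sub_apply_pow_of_mem_integralRUp hp hf
  have hm0 : m ≠ 0 := fun h0 => hm (by simp [h0])
  obtain ⟨k, rfl⟩ : ∃ k : ℕ, g ^ k = g' := by
    have : g' ∈ Subgroup.zpowers g := hgg' ▸ Subgroup.mem_zpowers g'
    exact mem_powers_iff_mem_zpowers.mpr this
  have hcop : (orderOf g).Coprime k := by
    have h1 : orderOf (g ^ k) = orderOf g := by
      rw [← Nat.card_zpowers, ← Nat.card_zpowers, hgg']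
    rw [orderOf_pow] at h1
    have := Nat.div_eq_self.mp h1
    exact this.resolve_left (orderOf_pos g).ne'
  have : NeZero (orderOf g) := ⟨(orderOf_pos g).ne'⟩
  obtain ⟨q, hqgt, hq, hqk⟩ := Nat.forall_exists_prime_gt_and_eq_mod
    ((ZMod.isUnit_iff_coprime k (orderOf g)).mpr hcop.symm) (max m (f g - f (g ^ k)).natAbs)
  have hqm : ¬ q ∣ m := fun hd =>
    absurd (Nat.le_of_dvd (Nat.pos_of_ne_zero hm0) hd) (by omega)
  have hgq : g ^ q = g ^ k :=
    pow_eq_pow_iff_modEq.mpr ((ZMod.natCast_eq_natCast_iff _ _ _).mp hqk)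
  have hd := h q hq hqm g
  rw [hgq] at hd
  by_contra hne
  have := Int.natAbs_dvd_natAbs.mpr hd
  have := Nat.le_of_dvd (Int.natAbs_pos.mpr (sub_ne_zero.mpr hne)) this
  simp only [Int.natAbs_natCast] at this
  omega

theorem character_conj_of_mem_RUpAlgebra {G : Type} [Group G] {p : ℕ} {f : G → ℂ}
    (hf : f ∈ RUpAlgebra G p) (g h : G) : f (h * g * h⁻¹) = f g := by
  induction hf using Algebra.adjoin_induction with
  | mem f hf =>
    obtain ⟨V, rfl⟩ := hf
    exact FDRep.char_conj V g h
  | algebraMap c => rfl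
  | add x y _ _ hx hy => simp only [Pi.add_apply, hx, hy]
  | mul x y _ _ hx hy => simp only [Pi.mul_apply, hx, hy]

theorem apply_conj_of_mem_integralRUp {G : Type} [Group G] {p : ℕ} {f : G → ℤ}
    (hf : f ∈ integralRUp G p) (g h : G) : f (h * g * h⁻¹) = f g := by
  exact Int.cast_injective (character_conj_of_mem_RUpAlgebra hf g h)

theorem card_fixedBy_mem_integralRUp {G X : Type} [Group G] [Fintype G] [MulAction G X] [Finite X]
    (p : ℕ) : (fun g : G => (Nat.card (MulAction.fixedBy X g) : ℤ)) ∈ integralRUp G p := by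
  have := Fintype.ofFinite X
  let ρ : Representation ℂ G (X → ℂ) :=
    { toFun := fun g => LinearMap.funLeft ℂ ℂ fun x => g⁻¹ • x
      map_one' := by ext; simp
      map_mul' := fun g h => by
        ext
        simp [LinearMap.funLeft, mul_smul] }
  rw [mem_integralRUp_iff, ← mem_RUpAlgebra_iff]
  refine Algebra.subset_adjoin ⟨FDRep.of ρ, ?_⟩
  ext g
  change LinearMap.trace ℂ (X → ℂ) (ρ g) = _
  rw [LinearMap.trace_eq_matrix_trace ℂ (Pi.basisFun ℂ X), Matrix.trace]
  have h : ∀ x : X, LinearMap.toMatrix (Pi.basisFun ℂ X) (Pi.basisFun ℂ X) (ρ g) x x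
      = if g • x = x then 1 else 0 := by
    intro x
    rw [LinearMap.toMatrix_apply]
    simp only [Pi.basisFun_apply, Pi.basisFun_repr]
    change (Pi.single x 1 : X → ℂ) (g⁻¹ • x) = _
    rw [Pi.single_apply]
    exact if_congr (inv_smul_eq_iff.trans eq_comm) rfl rfl
  simp only [Matrix.diag_apply, h, Finset.sum_boole]
  rw [Nat.card_eq_fintype_card, Fintype.card_subtype]
  simp [MulAction.mem_fixedBy]

/-- The number of `x` conjugating `g` into the subgroup `A`. -/
noncomputable def cardConjMem {G : Type} [Group G] (A : Subgroup G) (g : G) : ℤ :=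
  Nat.card {x : G // x * g * x⁻¹ ∈ A}

/-- The number of `x` conjugating the cyclic group generated by `g` to the subgroup `A`. -/
noncomputable def cardConjEq {G : Type} [Group G] (A : Subgroup G) (g : G) : ℤ :=
  Nat.card {x : G // Subgroup.zpowers (x * g * x⁻¹) = A}

theorem cardConjMem_eq_card_mul_card_fixedBy {G : Type} [Group G] (H : Subgroup G) (g : G) :
    cardConjMem H g = Nat.card H * Nat.card (MulAction.fixedBy (G ⧸ H) g) := by
  rw [cardConjMem, ← Nat.cast_mul, ← Nat.card_prod,
    ← Nat.card_congr (QuotientGroup.preimageMkEquivSubgroupProdSet H _)]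
  congr 1
  refine Nat.card_congr ((Equiv.inv G).subtypeEquiv fun x => ?_)
  rw [Set.mem_preimage, MulAction.mem_fixedBy, MulAction.Quotient.smul_mk, eq_comm,
    QuotientGroup.eq]
  simp [mul_assoc]

theorem cardConjMem_eq_sum_cardConjEq {G : Type} [Group G] [Fintype G] (A : Subgroup G) (g : G) :
    cardConjMem A g = ∑ B with B ≤ A, cardConjEq B g := by
  simp only [cardConjMem, cardConjEq, Nat.card_eq_fintype_card, Fintype.card_subtype]
  rw [← Nat.cast_sum, Finset.card_eq_sum_card_fiberwise
    (f := fun x => Subgroup.zpowers (x * g * x⁻¹)) (t := {B : Subgroup G | B ≤ A})]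
  · congr 1
    refine Finset.sum_congr rfl fun B hB => ?_
    congr 1
    ext x
    simp only [Finset.mem_filter, Finset.mem_univ, true_and] at hB ⊢
    refine ⟨fun h => h.2, fun h => ⟨hB (h ▸ Subgroup.mem_zpowers _), h⟩⟩
  · intro x hx
    simpa using hx

/-- Inversion of `cardConjMem_eq_sum_cardConjEq` inside the ring of integer-valued elements. -/
theorem exists_mem_integralRUp_mul_eq_cardConjEq {G : Type} [Group G] [Fintype G] {p : ℕ}
    (S : Set G) (N : ℤ) (C : Subgroup G)
    (h : ∀ B ≤ C, ∃ σ ∈ integralRUp G p, ∀ g ∈ S, N * σ g = cardConjMem B g) :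
    ∃ u ∈ integralRUp G p, ∀ g ∈ S, N * u g = cardConjEq C g := by
  have : WellFoundedLT (Subgroup G) := inferInstance
  induction C using this.induction with
  | ind C ih =>
    obtain ⟨σ, hσ, hσN⟩ := h C le_rfl
    choose u hu huN using fun (B : {B : Subgroup G // B < C}) =>
      ih B.1 B.2 fun D hD => h D (hD.trans B.2.le)
    refine ⟨σ - ∑ B, u B, sub_mem hσ (sum_mem fun B _ => hu B), fun g hg => ?_⟩
    rw [Pi.sub_apply, Finset.sum_apply, mul_sub, hσN g hg, cardConjMem_eq_sum_cardConjEq,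
      Finset.mul_sum, Finset.sum_congr rfl fun B _ => huN B g hg]
    have h1 : ({B : Subgroup G | B ≤ C} : Finset (Subgroup G))
        = insert C ({B : Subgroup G | B < C} : Finset (Subgroup G)) := by
      ext B
      simp [le_iff_eq_or_lt]
    rw [h1, Finset.sum_insert (by simp)]
    rw [Finset.sum_subtype (p := fun B => B < C) _ (by simp)]
    ring

theorem cardConjEq_mem_integralRUp {G : Type} [Group G] [Fintype G] (p : ℕ) (A : Subgroup G) :
    cardConjEq A ∈ integralRUp G p := by
  obtain ⟨u, hu, h⟩ := exists_mem_integralRUp_mul_eq_cardConjEq (p := p) Set.univ 1 A fun B _ =>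
    ⟨cardConjMem B, by
      rw [funext (cardConjMem_eq_card_mul_card_fixedBy B)]
      exact mul_mem (natCast_mem _ (Nat.card B))
        (card_fixedBy_mem_integralRUp (G := G) (X := G ⧸ B) p), by simp⟩
  convert hu
  ext g
  simpa using (h g trivial).symm

/-- Artin's theorem for functions which depend only on the conjugacy class of the generated
cyclic subgroup. -/
theorem card_mul_mem_integralRUp {G : Type} [Group G] [Fintype G] (p : ℕ) {w : G → ℤ}
    (hconj : ∀ g x, w (x * g * x⁻¹) = w g)
    (hz : ∀ g g', Subgroup.zpowers g = Subgroup.zpowers g' → w g = w g') :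
    (Nat.card G : G → ℤ) * w ∈ integralRUp G p := by
  have hw : Function.FactorsThrough w (Subgroup.zpowers (G := G)) := fun g g' h => hz g g' h
  let W : Subgroup G → ℤ := Function.extend (Subgroup.zpowers (G := G)) w 0
  have key : (Nat.card G : G → ℤ) * w = ∑ A, (W A : G → ℤ) * cardConjEq A := by
    ext g
    simp only [Pi.mul_apply, Finset.sum_apply, Pi.natCast_apply, Pi.intCast_apply]
    have h1 : ∑ x : G, W (Subgroup.zpowers (x * g * x⁻¹)) = Nat.card G * w g := by
      simp [W, hw.extend_apply, hconj]
    rw [← h1, ← Finset.sum_fiberwise_of_maps_to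
      (g := fun x => Subgroup.zpowers (x * g * x⁻¹)) (t := Finset.univ) (by simp)]
    refine Finset.sum_congr rfl fun A _ => ?_
    rw [Finset.sum_congr rfl fun x hx => by rw [(Finset.mem_filter.mp hx).2]]
    rw [Finset.sum_const, cardConjEq, Nat.card_eq_fintype_card, Fintype.card_subtype, nsmul_eq_mul,
      mul_comm]
    rfl
  rw [key]
  exact sum_mem fun A _ => mul_mem (intCast_mem _ _) (cardConjEq_mem_integralRUp p A)

theorem cardConjEq_eq_card_normalizer {G : Type} [Group G] {A : Subgroup G} {g x₀ : G}
    (hx₀ : Subgroup.zpowers (x₀ * g * x₀⁻¹) = A) :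
    cardConjEq A g = Nat.card (Subgroup.normalizer (A : Set G)) := by
  rw [cardConjEq]
  congr 1
  refine Nat.card_congr ((Equiv.mulRight x₀⁻¹).subtypeEquiv fun x => ?_)
  have h : Subgroup.zpowers (x * g * x⁻¹) = A.map (MulAut.conj (x * x₀⁻¹)).toMonoidHom := by
    rw [← hx₀, MonoidHom.map_zpowers]
    congr 1
    simp [mul_assoc]
  rw [h]
  exact Subgroup.mem_normalizer_iff_map_conj_eq.symm

theorem Subgroup.normalizer_le_normalizer_of_isCyclic {G : Type} [Group G] {B C : Subgroup G}
    (hC : IsCyclic C) (hBC : B ≤ C) :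
    Subgroup.normalizer (C : Set G) ≤ Subgroup.normalizer (B : Set G) := by
  obtain ⟨c, rfl⟩ := (Subgroup.isCyclic_iff_exists_zpowers_eq_top C).mp hC
  have key : ∀ n ∈ Subgroup.normalizer (Subgroup.zpowers c : Set G), ∀ b ∈ B,
      n * b * n⁻¹ ∈ B := by
    intro n hn b hb
    obtain ⟨k, hk⟩ := Subgroup.mem_zpowers_iff.mp
      ((Subgroup.mem_normalizer_iff.mp hn c).mp (Subgroup.mem_zpowers c))
    obtain ⟨j, rfl⟩ := Subgroup.mem_zpowers_iff.mp (hBC hb)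
    rw [← conj_zpow, ← hk, ← zpow_mul, mul_comm, zpow_mul]
    exact B.zpow_mem hb k
  intro n hn
  rw [Subgroup.mem_normalizer_iff]
  refine fun b => ⟨key n hn b, fun h => ?_⟩
  simpa [mul_assoc] using key n⁻¹ (inv_mem hn) _ h

theorem Subgroup.card_sup_of_le_normalizer {G : Type} [Group G] [Finite G] {B P : Subgroup G}
    (hP : P ≤ Subgroup.normalizer (B : Set G)) (hcop : (Nat.card B).Coprime (Nat.card P)) :
    Nat.card (B ⊔ P : Subgroup G) = Nat.card B * Nat.card P := by
  have hinj := Subgroup.mul_injective_of_disjoint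
    (Subgroup.disjoint_of_coprime_natCard hcop)
  have h : (B ⊔ P : Subgroup G) = (Set.range fun g : B × P => (g.1 * g.2 : G)) := by
    rw [Subgroup.coe_mul_of_right_le_normalizer_left B P hP]
    ext x
    simp [Set.mem_mul]
  rw [← Nat.card_prod, Nat.card_congr (Equiv.ofInjective _ hinj), ← h]
  rfl

theorem Subgroup.mem_of_mem_sup_of_coprime {G : Type} [Group G] [Finite G] {B P : Subgroup G}
    (hP : P ≤ Subgroup.normalizer (B : Set G)) (hcop : (Nat.card B).Coprime (Nat.card P)) {y : G}
    (hy : y ∈ B ⊔ P) (hyP : (orderOf y).Coprime (Nat.card P)) : y ∈ B := by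
  have hn : (B.subgroupOf (B ⊔ P)).Normal :=
    Subgroup.normal_subgroupOf_of_le_normalizer (sup_le Subgroup.le_normalizer hP)
  have hidx : (B.subgroupOf (B ⊔ P)).index = Nat.card P := by
    have h := Subgroup.card_mul_index (B.subgroupOf (B ⊔ P))
    rw [Subgroup.card_sup_of_le_normalizer hP hcop,
      Nat.card_congr (Subgroup.subgroupOfEquivOfLe le_sup_left).toEquiv] at h
    exact Nat.eq_of_mul_eq_mul_left Nat.card_pos h
  have hpow : y ^ Nat.card P ∈ B := by
    have h := (B.subgroupOf (B ⊔ P)).pow_index_mem ⟨y, hy⟩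
    rwa [hidx, Subgroup.mem_subgroupOf] at h
  obtain ⟨k, hk⟩ := exists_pow_eq_self_of_coprime hyP.symm
  rw [← hk]
  exact pow_mem hpow k

theorem Subgroup.exists_le_card_eq_prime_pow_mul {G : Type} [Group G] [Finite G] {p : ℕ}
    (hp : p.Prime) (N : Subgroup G) :
    ∃ P ≤ N, (∃ k, Nat.card P = p ^ k) ∧ ∃ m, ¬ p ∣ m ∧ Nat.card N = Nat.card P * m := by
  have : Fact p.Prime := ⟨hp⟩
  let Q : Sylow p N := default
  have hPcard : Nat.card (Q.toSubgroup.map N.subtype) = Nat.card Q.toSubgroup :=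
    Subgroup.card_map_of_injective N.subtype_injective
  refine ⟨Q.toSubgroup.map N.subtype, Subgroup.map_subtype_le _, ?_, Q.toSubgroup.index,
    Q.not_dvd_index, ?_⟩
  · rw [hPcard]
    exact IsPGroup.iff_card.mp Q.isPGroup'
  · rw [hPcard, Subgroup.card_mul_index]

theorem exists_mem_integralRUp_apply_eq_ite {G : Type} [Group G] [Fintype G] {p : ℕ}
    (hp : p.Prime) (C : Subgroup G) (hC : IsCyclic C) (hord : ¬ p ∣ Nat.card C) :
    ∃ u ∈ integralRUp G p, ∃ m : ℤ, ¬ (p : ℤ) ∣ m ∧ ∀ c, ¬ p ∣ orderOf c →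
      u c = if SubConj (Subgroup.zpowers c) C then m else 0 := by
  obtain ⟨P, hPle, ⟨k, hk⟩, m, hm, hNcard⟩ :=
    Subgroup.exists_le_card_eq_prime_pow_mul hp (Subgroup.normalizer (C : Set G))
  have hcopP : ∀ n : ℕ, ¬ p ∣ n → n.Coprime (Nat.card P) := by
    intro n hn
    rw [hk]
    exact Nat.Coprime.pow_right _ ((Nat.Prime.coprime_iff_not_dvd hp).mpr hn).symm
  obtain ⟨u, hu, huP⟩ := exists_mem_integralRUp_mul_eq_cardConjEq (p := p)
    {c : G | ¬ p ∣ orderOf c} (Nat.card P) C fun B hB => by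
      have hBn := hPle.trans (Subgroup.normalizer_le_normalizer_of_isCyclic hC hB)
      have hBP : (Nat.card B).Coprime (Nat.card P) :=
        hcopP _ fun h => hord (h.trans (Subgroup.card_dvd_of_le hB))
      refine ⟨(Nat.card B : G → ℤ) *
        fun g => (Nat.card (MulAction.fixedBy (G ⧸ (B ⊔ P)) g) : ℤ),
        mul_mem (natCast_mem _ _) (card_fixedBy_mem_integralRUp p), fun c hc => ?_⟩
      have h1 : cardConjMem B c = cardConjMem (B ⊔ P) c := by
        rw [cardConjMem, cardConjMem]
        congr 1
        refine Nat.card_congr (Equiv.subtypeEquivRight fun x => ⟨fun h => le_sup_left (b := P) h,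
          fun h => Subgroup.mem_of_mem_sup_of_coprime hBn hBP h (hcopP _ ?_)⟩)
        have : orderOf (x * c * x⁻¹) = orderOf c :=
          orderOf_injective (MulAut.conj x).toMonoidHom (MulAut.conj x).injective c
        rwa [this]
      rw [h1, cardConjMem_eq_card_mul_card_fixedBy, Subgroup.card_sup_of_le_normalizer hBn hBP]
      simp only [Pi.mul_apply, Pi.natCast_apply]
      push_cast
      ring
  have hP0 : (Nat.card P : ℤ) ≠ 0 := by exact_mod_cast Nat.card_pos.ne'
  refine ⟨u, hu, m, fun h => hm (by exact_mod_cast h),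
    fun c hc => mul_left_cancel₀ hP0 ?_⟩
  have hconj : ∀ x : G, (Subgroup.zpowers c).map (MulAut.conj x).toMonoidHom
      = Subgroup.zpowers (x * c * x⁻¹) := fun x => MonoidHom.map_zpowers _ _
  rw [huP c hc]
  split_ifs with h
  · obtain ⟨x, hx⟩ := h
    rw [hconj] at hx
    rw [cardConjEq_eq_card_normalizer hx, hNcard, Nat.cast_mul]
  · rw [mul_zero, cardConjEq, Nat.cast_eq_zero]
    have : IsEmpty {x : G // Subgroup.zpowers (x * c * x⁻¹) = C} :=
      ⟨fun x => h ⟨x.1, (hconj _).trans x.2⟩⟩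
    exact Nat.card_of_isEmpty

/-- The `p'`-part is given by a uniform power. -/
theorem exists_ispPrimePart_iff_eq_pow (G : Type) [Group G] [Finite G] {p : ℕ} (hp : p.Prime) :
    ∃ K a : ℕ, (∀ g b : G, IspPrimePart p g b ↔ b = g ^ K) ∧
      ∀ g : G, (g ^ K) ^ p ^ a = g ^ p ^ a := by
  obtain ⟨a, s, hs, hG⟩ := Nat.exists_eq_pow_mul_and_not_dvd (Nat.card_pos (α := G)).ne' p
    hp.ne_one
  have hcop : (p ^ a).Coprime s := Nat.Coprime.pow_left _ ((hp.coprime_iff_not_dvd).mpr hs)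
  obtain ⟨K, hK0, hK1⟩ := Nat.chineseRemainder hcop 0 1
  have hone : ∀ (g : G) (n : ℕ), p ^ a * s ∣ n → g ^ n = 1 := fun g n h =>
    orderOf_dvd_iff_pow_eq_one.mp ((orderOf_dvd_natCard g).trans (hG ▸ h))
  have hKa : p ^ a ∣ K := (Nat.modEq_zero_iff_dvd).mp hK0
  have hKpow : ∀ g : G, (g ^ K) ^ p ^ a = g ^ p ^ a := by
    intro g
    rw [← pow_mul, pow_eq_pow_iff_modEq]
    refine Nat.ModEq.of_dvd (hG ▸ orderOf_dvd_natCard g) ?_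
    have := hK1.mul_left' (p ^ a)
    rwa [mul_one, mul_comm _ K] at this
  refine ⟨K, a, fun g b => ⟨fun ⟨hb, hbp, hbq⟩ => ?_, ?_⟩, hKpow⟩
  · have hcomm : Commute b (g * b⁻¹) := by
      obtain ⟨k, rfl⟩ := Subgroup.mem_zpowers_iff.mp hb
      exact ((Commute.refl g).zpow_left k).mul_right (Commute.refl _).inv_right
    have hu : orderOf (g * b⁻¹) ∣ K := by
      refine dvd_trans (Nat.Coprime.dvd_of_dvd_mul_right ?_ (hG ▸ orderOf_dvd_natCard _)) hKa
      by_contra h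
      obtain ⟨q, hq, hq1, hq2⟩ := Nat.Prime.not_coprime_iff_dvd.mp h
      exact hs (hbq q hq hq1 ▸ hq2)
    have hbs : orderOf b ∣ s :=
      Nat.Coprime.dvd_of_dvd_mul_left
        (Nat.Coprime.pow_right _ ((hp.coprime_iff_not_dvd).mpr hbp).symm)
        (hG ▸ orderOf_dvd_natCard b)
    have hbK : b ^ K = b := by
      conv_rhs => rw [← pow_one b]
      exact pow_eq_pow_iff_modEq.mpr (hK1.of_dvd hbs)
    have hg : g = b * (g * b⁻¹) := by rw [hcomm.eq]; simp
    rw [hg, hcomm.mul_pow, hbK, orderOf_dvd_iff_pow_eq_one.mp hu, mul_one]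
  · rintro rfl
    refine ⟨pow_mem (Subgroup.mem_zpowers g) K, fun h => ?_, fun q hq h => ?_⟩
    · have : orderOf (g ^ K) ∣ s := by
        rw [orderOf_dvd_iff_pow_eq_one, ← pow_mul]
        exact hone g _ (mul_dvd_mul_right hKa s)
      exact hs (h.trans this)
    · have h1 : orderOf (g * (g ^ K)⁻¹) ∣ p ^ a := by
        rw [orderOf_dvd_iff_pow_eq_one, ((Commute.refl g).pow_right K).inv_right.mul_pow, inv_pow,
          hKpow, mul_inv_cancel]
      exact (Nat.prime_dvd_prime_iff_eq hq hp).mp (hq.dvd_of_dvd_pow (h.trans h1))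

theorem subConj_map_conj_iff {G : Type} [Group G] {A C : Subgroup G} (x : G) :
    SubConj (A.map (MulAut.conj x).toMonoidHom) C ↔ SubConj A C := by
  have h : ∀ y, (A.map (MulAut.conj x).toMonoidHom).map (MulAut.conj y).toMonoidHom
      = A.map (MulAut.conj (y * x)).toMonoidHom := by
    intro y
    rw [Subgroup.map_map]
    congr 1
    ext z
    simp [mul_assoc]
  constructor
  · rintro ⟨y, hy⟩
    exact ⟨y * x, (h y).symm.trans hy⟩
  · rintro ⟨y, hy⟩
    exact ⟨y * x⁻¹, by rw [h, inv_mul_cancel_right, hy]⟩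

/-- If `u` is an integer-valued element of `RU_(p)(G)`, then so is the indicator function of the set
where `u` is prime to `p`: it is approximated `p`-adically by powers of `u`. -/
theorem indicator_mem_integralRUp {G : Type} [Group G] [Fintype G] {p : ℕ} (hp : p.Prime)
    {e u : G → ℤ} (hu : u ∈ integralRUp G p)
    (heu : ∀ g, e g = 1 ∧ ¬ (p : ℤ) ∣ u g ∨ e g = 0 ∧ (p : ℤ) ∣ u g)
    (hconj : ∀ g x, e (x * g * x⁻¹) = e g)
    (hz : ∀ g g', Subgroup.zpowers g = Subgroup.zpowers g' → e g = e g') :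
    e ∈ integralRUp G p := by
  obtain ⟨r, s, hs, hG⟩ := Nat.exists_eq_pow_mul_and_not_dvd (Nat.card_pos (α := G)).ne' p
    hp.ne_one
  let E := Nat.totient (p ^ r) * r
  have hE : r ≤ E := Nat.le_mul_of_pos_left _ (Nat.totient_pos.mpr (pow_pos hp.pos r))
  have hv : u ^ E ∈ integralRUp G p := pow_mem hu E
  have hdvd : ∀ g, (p : ℤ) ^ r ∣ e g - (u ^ E) g := by
    intro g
    rcases heu g with ⟨h1, h2⟩ | ⟨h1, h2⟩
    · rw [h1, Pi.pow_apply]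
      have hcop : IsCoprime (u g) ((p ^ r : ℕ) : ℤ) := by
        push_cast
        exact (((Nat.prime_iff_prime_int.mp hp).coprime_iff_not_dvd).mpr h2).symm.pow_right
      have hunit : IsUnit ((u g : ℤ) : ZMod (p ^ r)) :=
        (ZMod.coe_int_isUnit_iff_isCoprime _ _).mpr hcop.symm
      have h3 : (((1 - u g ^ E : ℤ)) : ZMod (p ^ r)) = 0 := by
        obtain ⟨y, hy⟩ := hunit
        push_cast
        simp only [E]
        rw [← hy, pow_mul, ← Units.val_pow_eq_pow_val, ZMod.pow_totient]
        simp
      simpa using (ZMod.intCast_zmod_eq_zero_iff_dvd _ _).mp h3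
    · rw [h1, Pi.pow_apply, zero_sub, dvd_neg]
      exact (pow_dvd_pow_of_dvd h2 r).trans (pow_dvd_pow _ hE)
  let w : G → ℤ := fun g => (e g - (u ^ E) g) / p ^ r
  have hw : (Nat.card G : G → ℤ) * w ∈ integralRUp G p := by
    refine card_mul_mem_integralRUp p (fun g x => ?_) (fun g g' h => ?_)
    · simp only [w, hconj, apply_conj_of_mem_integralRUp hv]
    · simp only [w, hz g g' h, apply_eq_of_zpowers_eq_of_mem_integralRUp hp hv h]
  have hsub : e - u ^ E ∈ integralRUp G p := by
    refine mem_integralRUp_of_natCast_mul_mem hs ?_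
    convert hw using 1
    ext g
    have : (p : ℤ) ^ r * w g = e g - (u ^ E) g := Int.mul_ediv_cancel' (hdvd g)
    simp only [Pi.mul_apply, Pi.natCast_apply, Pi.sub_apply]
    rw [← this, hG]
    push_cast
    ring
  simpa using add_mem hsub hv

/-- STATEMENT 18: for a prime `p` and a cyclic subgroup `C ≤ G` of order prime to `p`,
the function `e_C` lies in `RU_(p)(G)` and is a primitive idempotent there. -/
theorem eCycp_primitive_idempotent_p_local (G : Type) [Group G] [Fintype G]
    (p : ℕ) (hp : p.Prime) (C : Subgroup G) (hC : IsCyclic C) (hord : ¬ p ∣ Nat.card C) :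
    eCycp p C ∈ RUp G p ∧ IsPrimitiveIdempotentIn (RUp G p) (eCycp p C) := by
  obtain ⟨K, a, hK, hKa⟩ := exists_ispPrimePart_iff_eq_pow G hp
  have hcongr : ∀ f ∈ integralRUp G p, ∀ g, (p : ℤ) ∣ f g - f (g ^ K) := by
    intro f hf g
    have := dvd_sub (dvd_sub_apply_pow_pow_of_mem_integralRUp hp hf g a)
      (dvd_sub_apply_pow_pow_of_mem_integralRUp hp hf (g ^ K) a)
    rwa [hKa, sub_sub_sub_cancel_right] at this
  let e : G → ℤ := fun g => if SubConj (Subgroup.zpowers (g ^ K)) C then 1 else 0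
  have he : eCycp p C = fun g => (e g : ℂ) := by
    ext g
    simp [eCycp, e, hK]
  have hmem : e ∈ integralRUp G p := by
    obtain ⟨u, hu, m, hm, h⟩ := exists_mem_integralRUp_apply_eq_ite hp C hC hord
    refine indicator_mem_integralRUp hp hu (fun g => ?_) (fun g x => ?_) (fun g g' hgg' => ?_)
    · have h1 := h (g ^ K) ((hK g _).mpr rfl).2.1
      have h2 := dvd_iff_dvd_of_dvd_sub (hcongr u hu g)
      rw [h2, h1]
      by_cases hg : SubConj (Subgroup.zpowers (g ^ K)) C
      · simp [e, hg, hm]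
      · simp [e, hg]
    · have : Subgroup.zpowers ((x * g * x⁻¹) ^ K)
          = (Subgroup.zpowers (g ^ K)).map (MulAut.conj x).toMonoidHom := by
        rw [MonoidHom.map_zpowers, conj_pow]
        rfl
      simp only [e, this, subConj_map_conj_iff]
    · have : Subgroup.zpowers (g ^ K) = Subgroup.zpowers (g' ^ K) := by
        have hle : ∀ x y : G, Subgroup.zpowers x = Subgroup.zpowers y →
            Subgroup.zpowers (x ^ K) ≤ Subgroup.zpowers (y ^ K) := by
          intro x y hxy
          rw [Subgroup.zpowers_le]
          obtain ⟨k, rfl⟩ := Subgroup.mem_zpowers_iff.mp (hxy ▸ Subgroup.mem_zpowers x)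
          have : (y ^ k) ^ K = (y ^ K) ^ k := by
            rw [← zpow_natCast, ← zpow_natCast, ← zpow_mul, ← zpow_mul, mul_comm]
          rw [this]
          exact Subgroup.zpow_mem_zpowers _ _
        exact le_antisymm (hle g g' hgg') (hle g' g hgg'.symm)
      simp only [e, this]
  have heRUp : eCycp p C ∈ RUp G p := he ▸ mem_integralRUp_iff.mp hmem
  refine ⟨heRUp, heRUp, ?_, ?_, ?_⟩
  · ext g
    simp [eCycp]
  · obtain ⟨c, rfl⟩ := (Subgroup.isCyclic_iff_exists_zpowers_eq_top C).mp hC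
    intro h0
    have h1 : eCycp p (Subgroup.zpowers c) c = 1 := by
      refine if_pos ⟨c, ⟨Subgroup.mem_zpowers c, ?_, fun q hq h => ?_⟩, 1, ?_⟩
      · rwa [← Nat.card_zpowers]
      · simp [hq.ne_one] at h
      · ext; simp
    simp [h0] at h1
  · intro e₁ e₂ h₁ h₂ hi₁ hi₂ h₁₂ hsum
    have hval : ∀ g, e₁ g = 0 ∨ e₁ g = 1 := fun g =>
      IsIdempotentElem.iff_eq_zero_or_one.mp (congrFun hi₁ g)
    have hval' : ∀ g, e₂ g = 0 ∨ e₂ g = 1 := fun g =>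
      IsIdempotentElem.iff_eq_zero_or_one.mp (congrFun hi₂ g)
    let f : G → ℤ := fun g => if e₁ g = 1 then 1 else 0
    have hfe : ∀ g, e₁ g = f g := fun g => by
      rcases hval g with h | h <;> simp [f, h]
    have hf : f ∈ integralRUp G p := by
      rw [mem_integralRUp_iff, ← funext hfe]
      exact h₁
    have hfK : ∀ g, f g = f (g ^ K) := fun g => by
      have h := hcongr f hf g
      have := hp.two_le
      have habs : |f g - f (g ^ K)| < p := by
        simp only [f]
        split_ifs <;> norm_num <;> omega
      exact sub_eq_zero.mp (Int.eq_zero_of_abs_lt_dvd h habs)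
    have hsupp : ∀ g, eCycp p C g ≠ 0 → ∃ x, Subgroup.zpowers (x * g ^ K * x⁻¹) = C := by
      intro g hg
      have hg' : SubConj (Subgroup.zpowers (g ^ K)) C := by
        by_contra h
        simp [he, e, h] at hg
      obtain ⟨x, hx⟩ := hg'
      exact ⟨x, (MonoidHom.map_zpowers _ _).symm.trans hx⟩
    have hconst : ∀ g g', eCycp p C g ≠ 0 → eCycp p C g' ≠ 0 → f g = f g' := by
      intro g g' hg hg'
      obtain ⟨x, hx⟩ := hsupp g hg
      obtain ⟨x', hx'⟩ := hsupp g' hg'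
      rw [hfK g, hfK g', ← apply_conj_of_mem_integralRUp hf _ x,
        ← apply_conj_of_mem_integralRUp hf (g' ^ K) x',
        apply_eq_of_zpowers_eq_of_mem_integralRUp hp hf (hx.trans hx'.symm)]
    have hoff : ∀ g g', e₁ g = 1 → e₂ g' = 1 → False := by
      intro g g' hg hg'
      have hz : e₂ g = 0 := by simpa [hg] using congrFun h₁₂ g
      have hz' : e₁ g' = 0 := by simpa [hg'] using congrFun h₁₂ g'
      have h := hconst g g' (by simp [hsum, hg, hz]) (by simp [hsum, hg', hz'])
      have h' : e₁ g = e₁ g' := by rw [hfe, hfe, h]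
      rw [hg, hz'] at h'
      exact one_ne_zero h'
    by_contra! h
    obtain ⟨g, hg⟩ := Function.ne_iff.mp h.1
    obtain ⟨g', hg'⟩ := Function.ne_iff.mp h.2
    exact hoff g g' ((hval g).resolve_left hg) ((hval' g').resolve_left hg')
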